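/- arXiv:1909.05113 — 3 statements merged into one kernel-verified Lean document; each statement's English description precedes it below -/
import Mathlib

section
/- Let X be a Polish space and (κ_t)_{t≥0} a semigroup of Markov kernels on X (κ_0(x,·) = δ_x and κ_{t+s} = κ_t κ_s) such that: (i) Feller property: for every f ∈ C_b(X) and t ≥ 0 the function S(t)f(x) := ∫ f dκ_t(x,·) is continuous (hence S(t) maps C_b(X) into C_b(X)); (ii) compact containment: for every T > 0, every compact K ⊆ X and every ε > 0 there is a compact K' ⊆ X such that κ_t(x, K') ≥ 1 − ε for all x ∈ K and t ∈ [0,T]; (iii) weak continuity: for every Borel probability measure μ on X and every f ∈ C_b(X), the map t ↦ ∫_X (S(t)f)(x) μ(dx) is continuous on [0,∞). Then for every f ∈ C_b(X), the map (t, x) ↦ S(t)f(x) is jointly continuous on [0,∞) × X. (This is an equivalent concrete formulation of the conclusion of Theorem 3.2: the transition semigroup is strongly continuous and locally equi-continuous for the strict topology.) -/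
open MeasureTheory Filter Topology

/-- A convex set of continuous functions on a compact space that contains a bounded sequence
converging pointwise to zero contains functions with arbitrarily small maximum. -/
lemma exists_mem_convex_forall_lt {Y : Type*} [TopologicalSpace Y] [CompactSpace Y] [T2Space Y]
    {C : Set C(Y, ℝ)} (hC : Convex ℝ C) {F : ℕ → C(Y, ℝ)} (hF : ∀ n, F n ∈ C)
    {M : ℝ} (hM : ∀ n y, |F n y| ≤ M) (hlim : ∀ y, Tendsto (fun n => F n y) atTop (𝓝 0))
    {ε : ℝ} (hε : 0 < ε) : ∃ g ∈ C, ∀ y, g y < ε := by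
  by_contra! hcon
  let s : Set C(Y, ℝ) := {u | ∀ y, u y < ε}
  have hs_open : IsOpen s := by
    have := ContinuousMap.isOpen_setOfPred_mapsTo (X := Y) (Y := ℝ) isCompact_univ
      (isOpen_Iio (a := ε))
    simpa [s, Set.MapsTo] using this
  have hs_conv : Convex ℝ s := by
    intro u hu v hv a b ha hb hab y
    exact (convex_Iio ε) (hu y) (hv y) ha hb hab
  have hdisj : Disjoint s C := by
    rw [Set.disjoint_left]
    intro u hu huC
    obtain ⟨y, hy⟩ := hcon u huC
    exact absurd (hu y) (not_lt.2 hy)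
  obtain ⟨φ, c, hs, hCφ⟩ := geometric_hahn_banach_open hs_conv hs_open hC hdisj
  have hc : 0 < c := by simpa using hs 0 (fun y => by simpa using hε)
  have hpos : ∀ u : C(Y, ℝ), (∀ y, 0 ≤ u y) → 0 ≤ φ u := by
    intro u hu
    by_contra! hneg
    have h := hs ((c / φ u) • u) (fun y => by
      have : c / φ u ≤ 0 := div_nonpos_of_nonneg_of_nonpos hc.le hneg.le
      have := mul_nonpos_of_nonpos_of_nonneg this (hu y)
      simp only [ContinuousMap.smul_apply, smul_eq_mul]
      linarith)
    rw [map_smul, smul_eq_mul, div_mul_cancel₀ _ hneg.ne] at h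
    exact lt_irrefl _ h
  borelize Y
  let Λ : CompactlySupportedContinuousMap Y ℝ →ₚ[ℝ] ℝ := PositiveLinearMap.mk₀
    { toFun := fun u => φ (u : C(Y, ℝ))
      map_add' := fun u v => map_add φ (u : C(Y, ℝ)) (v : C(Y, ℝ))
      map_smul' := fun a u => map_smul φ a (u : C(Y, ℝ)) }
    (fun u hu => hpos _ hu)
  let μ := RealRMK.rieszMeasure Λ
  have hint : ∀ u : C(Y, ℝ), ∫ y, u y ∂μ = φ u := fun u =>
    RealRMK.integral_rieszMeasure Λ (CompactlySupportedContinuousMap.continuousMapEquiv u)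
  have htend : Tendsto (fun n => ∫ y, F n y ∂μ) atTop (𝓝 (∫ _, (0 : ℝ) ∂μ)) :=
    tendsto_integral_of_dominated_convergence (fun _ => M)
      (fun n => (F n).continuous.measurable.aestronglyMeasurable) (integrable_const M)
      (fun n => .of_forall fun y => hM n y) (.of_forall hlim)
  have : c ≤ ∫ _, (0 : ℝ) ∂μ := ge_of_tendsto' htend fun n => by
    rw [hint]; exact hCφ _ (hF n)
  simp at this
  linarith

/-- A form of the lemma of Mazur: if a bounded sequence in a convex set of bounded continuous
functions converges pointwise, then elements of that set approximate the limit uniformly on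
compact sets. -/
lemma exists_mem_convex_forall_abs_sub_lt {X : Type*} [TopologicalSpace X] [T2Space X]
    {C : Set (BoundedContinuousFunction X ℝ)} (hC : Convex ℝ C)
    {F : ℕ → BoundedContinuousFunction X ℝ} (hF : ∀ n, F n ∈ C)
    {f : BoundedContinuousFunction X ℝ} {M : ℝ} (hM : ∀ n, ‖F n‖ ≤ M)
    (hlim : ∀ x, Tendsto (fun n => F n x) atTop (𝓝 (f x)))
    {K : Set X} (hK : IsCompact K) {ε : ℝ} (hε : 0 < ε) :
    ∃ g ∈ C, ∀ x ∈ K, |g x - f x| < ε := by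
  have : CompactSpace K := isCompact_iff_compactSpace.1 hK
  let D (g : BoundedContinuousFunction X ℝ) : C(K ⊕ K, ℝ) :=
    ⟨Sum.elim (fun x => g x - f x) (fun x => f x - g x), by fun_prop⟩
  have hD : Convex ℝ (D '' C) := by
    rintro _ ⟨u, hu, rfl⟩ _ ⟨v, hv, rfl⟩ a b ha hb hab
    refine ⟨a • u + b • v, hC hu hv ha hb hab, ?_⟩
    obtain rfl : b = 1 - a := by linarith
    ext (x | x) <;> simp [D] <;> ring
  obtain ⟨_, ⟨g, hg, rfl⟩, h⟩ := exists_mem_convex_forall_lt hD (F := fun n => D (F n))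
    (fun n => ⟨_, hF n, rfl⟩) (M := M + ‖f‖) (fun n y => by
      have h (x : X) : |F n x - f x| ≤ M + ‖f‖ := by
        have hFx : |F n x| ≤ M := ((F n).norm_coe_le_norm x).trans (hM n)
        have hfx : |f x| ≤ ‖f‖ := f.norm_coe_le_norm x
        linarith [abs_sub (F n x) (f x)]
      rcases y with x | x
      · exact h x
      · simpa [D, abs_sub_comm] using h x)
    (fun y => by
      rcases y with x | x
      · simpa [D] using (hlim x).sub_const (f x)
      · simpa [D] using (hlim x).const_sub (f x)) hε
  refine ⟨g, hg, fun x hx => abs_lt.2 ⟨?_, ?_⟩⟩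
  · have := h (.inr ⟨x, hx⟩)
    simp only [D, ContinuousMap.coe_mk, Sum.elim_inr] at this
    linarith
  · exact h (.inl ⟨x, hx⟩)

lemma abs_integral_comp_add_mul_sub_le {v : ℝ → ℝ} (hv : Continuous v) {M : ℝ}
    (hM : ∀ s, |v s| ≤ M) {h : ℝ} (hh : 0 < h) (a b : ℝ) :
    |(∫ s in (0 : ℝ)..1, v (a + h * s)) - ∫ s in (0 : ℝ)..1, v (b + h * s)| ≤
      2 * M / h * |a - b| := by
  have hi (p q : ℝ) : IntervalIntegrable v volume p q := hv.intervalIntegrable p q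
  have hbd (p q : ℝ) : |∫ s in p..q, v s| ≤ M * |q - p| := by
    rw [← Real.norm_eq_abs]
    exact intervalIntegral.norm_integral_le_of_norm_le_const fun s _ => hM s
  have key : h * ((∫ s in (0 : ℝ)..1, v (a + h * s)) - ∫ s in (0 : ℝ)..1, v (b + h * s)) =
      (∫ s in a..b, v s) - ∫ s in (a + h)..(b + h), v s := by
    have h1 (c : ℝ) : h * ∫ s in (0 : ℝ)..1, v (c + h * s) = ∫ s in c..(c + h), v s := by
      simp
    rw [mul_sub, h1, h1,
      intervalIntegral.integral_interval_sub_interval_comm (hi _ _) (hi _ _) (hi _ _)]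
  have h2 := abs_sub (∫ s in a..b, v s) (∫ s in (a + h)..(b + h), v s)
  have h3 := hbd a b
  have h4 := hbd (a + h) (b + h)
  rw [← key, abs_mul, abs_of_pos hh] at h2
  rw [add_sub_add_right_eq_sub] at h4
  rw [abs_sub_comm] at h3 h4
  rw [div_mul_eq_mul_div, le_div_iff₀ hh]
  linarith

/-- Two bounded functions that are close on a set of almost full measure have close integrals. -/
lemma abs_integral_sub_integral_le {X : Type*} [TopologicalSpace X] [MeasurableSpace X]
    [OpensMeasurableSpace X] {μ : Measure X} [IsProbabilityMeasure μ]
    {f g : BoundedContinuousFunction X ℝ} {M ε : ℝ} (hf : ‖f‖ ≤ M) (hg : ‖g‖ ≤ M)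
    (hε : 0 ≤ ε) {K : Set X} (hK : MeasurableSet K) (hfg : ∀ x ∈ K, |g x - f x| ≤ ε)
    (hμ : ENNReal.ofReal (1 - ε) ≤ μ K) :
    |∫ x, g x ∂μ - ∫ x, f x ∂μ| ≤ ε + 2 * M * ε := by
  have hM : 0 ≤ M := (norm_nonneg _).trans hf
  have hcompl : μ.real Kᶜ ≤ ε := by
    have := (ENNReal.ofReal_le_iff_le_toReal (measure_ne_top μ K)).1 hμ
    rw [measureReal_compl hK, probReal_univ, measureReal_def]
    linarith
  have hbound (x : X) : ‖g x - f x‖ ≤ ε + Kᶜ.indicator (fun _ => 2 * M) x := by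
    by_cases hx : x ∈ K
    · simpa [hx] using hfg x hx
    · have h1 := (g.norm_coe_le_norm x).trans hg
      have h2 := (f.norm_coe_le_norm x).trans hf
      have h3 := norm_sub_le (g x) (f x)
      simp only [Set.mem_compl_iff, hx, not_false_eq_true, Set.indicator_of_mem]
      linarith
  rw [← integral_sub (g.integrable μ) (f.integrable μ)]
  have hind : Integrable (Kᶜ.indicator fun _ => 2 * M) μ :=
    (integrable_const _).indicator hK.compl
  calc |∫ x, (g x - f x) ∂μ| ≤ ∫ x, (ε + Kᶜ.indicator (fun _ => 2 * M) x) ∂μ :=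
        norm_integral_le_of_norm_le ((integrable_const ε).add hind) (.of_forall hbound)
    _ = ε + μ.real Kᶜ * (2 * M) := by
        rw [integral_add (integrable_const ε) hind, integral_indicator_const _ hK.compl]
        simp
    _ ≤ ε + 2 * M * ε := by nlinarith

section Semigroup

variable {X : Type*} [TopologicalSpace X] [MeasurableSpace X] [BorelSpace X]

/-- The bounded continuous functions of norm at most `M` whose orbit under the transition
semigroup is Lipschitz in time, uniformly in space. -/
def lipschitzOrbit (κ : ℝ → X → Measure X) (M : ℝ) : Set (BoundedContinuousFunction X ℝ) :=
  {g | ‖g‖ ≤ M ∧ ∃ L : ℝ, ∀ s ≥ (0 : ℝ), ∀ t ≥ (0 : ℝ), ∀ x,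
    |∫ y, g y ∂(κ s x) - ∫ y, g y ∂(κ t x)| ≤ L * |s - t|}

lemma convex_lipschitzOrbit {κ : ℝ → X → Measure X} (hprob : ∀ t x, IsProbabilityMeasure (κ t x))
    (M : ℝ) : Convex ℝ (lipschitzOrbit κ M) := by
  rintro u ⟨hu, A, hA⟩ v ⟨hv, B, hB⟩ a b ha hb hab
  refine ⟨?_, a * A + b * B, fun s hs t ht x => ?_⟩
  · simpa using (convex_closedBall (0 : BoundedContinuousFunction X ℝ) M)
      (by simpa using hu) (by simpa using hv) ha hb hab
  · have h (r : ℝ) : ∫ y, (a • u + b • v) y ∂(κ r x) =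
        a * ∫ y, u y ∂(κ r x) + b * ∫ y, v y ∂(κ r x) := by
      rw [← integral_const_mul, ← integral_const_mul, ← integral_add]
      · rfl
      · exact (u.integrable _).const_mul a
      · exact (v.integrable _).const_mul b
    rw [h, h]
    have h1 := mul_le_mul_of_nonneg_left (hA s hs t ht x) ha
    have h2 := mul_le_mul_of_nonneg_left (hB s hs t ht x) hb
    rw [← abs_of_nonneg ha, ← abs_mul, abs_of_nonneg ha] at h1
    rw [← abs_of_nonneg hb, ← abs_mul, abs_of_nonneg hb] at h2
    have h3 := abs_add_le (a * (∫ y, u y ∂(κ s x) - ∫ y, u y ∂(κ t x)))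
      (b * (∫ y, v y ∂(κ s x) - ∫ y, v y ∂(κ t x)))
    calc _ = |a * (∫ y, u y ∂(κ s x) - ∫ y, u y ∂(κ t x)) +
          b * (∫ y, v y ∂(κ s x) - ∫ y, v y ∂(κ t x))| := by congr 1; ring
      _ ≤ _ := by linarith

/-- Time averages of the orbit of `f` approximate `f` and have Lipschitz orbits. -/
lemma exists_seq_lipschitzOrbit_tendsto [PolishSpace X] {κ : ℝ → X → Measure X}
    (hmeas : ∀ t, Measurable (κ t))
    (hprob : ∀ t x, IsProbabilityMeasure (κ t x)) (hzero : ∀ x, κ 0 x = Measure.dirac x)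
    (hsemi : ∀ t ≥ (0 : ℝ), ∀ s ≥ (0 : ℝ), ∀ x, κ (t + s) x = (κ t x).bind (κ s))
    (f : BoundedContinuousFunction X ℝ)
    (hfeller : ∀ t ≥ (0 : ℝ), Continuous (fun x => ∫ y, f y ∂(κ t x)))
    (hcont : ∀ x, ContinuousOn (fun t => ∫ y, f y ∂(κ t x)) (Set.Ici 0)) :
    ∃ F : ℕ → BoundedContinuousFunction X ℝ, (∀ n, F n ∈ lipschitzOrbit κ ‖f‖) ∧
      ∀ x, Tendsto (fun n => F n x) atTop (𝓝 (f x)) := by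
  let u (s : ℝ) (x : X) : ℝ := ∫ y, f y ∂(κ (max s 0) x)
  have hu_time (x : X) : Continuous fun s => u s x :=
    (hcont x).comp_continuous (by fun_prop) fun s => le_max_right s 0
  have hu_space (s : ℝ) : Continuous (u s) := hfeller _ (le_max_right s 0)
  have hu_le (s : ℝ) (x : X) : ‖u s x‖ ≤ ‖f‖ := f.norm_integral_le_norm _
  have hu_zero (x : X) : u 0 x = f x := by simp [u, hzero]
  have hu_semi (t : ℝ) (ht : 0 ≤ t) (s : ℝ) (hs : 0 ≤ s) (x : X) :
      ∫ y, u s y ∂(κ t x) = u (t + s) x := by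
    let k (r : ℝ) : ProbabilityTheory.Kernel X X := ⟨κ r, hmeas r⟩
    have (r : ℝ) : ProbabilityTheory.IsMarkovKernel (k r) := ⟨hprob r⟩
    have h := ProbabilityTheory.Kernel.integral_comp (κ := k t) (η := k s) (a := x)
      (f.integrable ((ProbabilityTheory.Kernel.comp (k s) (k t)) x))
    rw [ProbabilityTheory.Kernel.comp_apply] at h
    simp only [u, max_eq_left hs, max_eq_left (add_nonneg ht hs), hsemi t ht s hs x]
    exact h.symm
  have hmeas_u : StronglyMeasurable (Function.uncurry u) :=
    stronglyMeasurable_uncurry_of_continuous_of_stronglyMeasurable hu_time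
      fun s => (hu_space s).stronglyMeasurable
  have havg_le (h : ℝ) (x : X) : ‖∫ s in (0 : ℝ)..1, u (h * s) x‖ ≤ ‖f‖ := by
    simpa using intervalIntegral.norm_integral_le_of_norm_le_const (a := 0) (b := 1)
      fun s _ => hu_le (h * s) x
  let A (h : ℝ) : BoundedContinuousFunction X ℝ :=
    BoundedContinuousFunction.ofNormedAddCommGroup (fun x => ∫ s in (0 : ℝ)..1, u (h * s) x)
      (intervalIntegral.continuous_of_dominated_interval (bound := fun _ => ‖f‖)
        (fun x => ((hu_time x).comp (continuous_const_mul h)).aestronglyMeasurable)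
        (fun x => .of_forall fun s _ => hu_le _ _) (by simp)
        (.of_forall fun s _ => hu_space _)) ‖f‖ (havg_le h)
  have hA_int (h : ℝ) (hh : 0 < h) (t : ℝ) (ht : 0 ≤ t) (x : X) :
      ∫ y, A h y ∂(κ t x) = ∫ s in (0 : ℝ)..1, u (t + h * s) x := by
    have hswap : ∫ y, (∫ s in Set.Ioc (0 : ℝ) 1, u (h * s) y) ∂(κ t x) =
        ∫ s in Set.Ioc (0 : ℝ) 1, ∫ y, u (h * s) y ∂(κ t x) := by
      refine integral_integral_swap (f := fun y s => u (h * s) y) ?_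
      refine Integrable.of_bound (C := ‖f‖) ?_ (.of_forall fun p => hu_le _ _)
      exact (hmeas_u.comp_measurable (g := fun p : X × ℝ => (h * p.2, p.1))
        (by fun_prop)).aestronglyMeasurable
    simp only [A, BoundedContinuousFunction.coe_ofNormedAddCommGroup,
      intervalIntegral.integral_of_le zero_le_one]
    rw [hswap]
    exact setIntegral_congr_fun measurableSet_Ioc fun s hs =>
      hu_semi t ht _ (mul_nonneg hh.le hs.1.le) x
  refine ⟨fun n => A (1 / ((n : ℝ) + 1)), fun n => ⟨?_, ?_⟩, fun x => ?_⟩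
  · exact BoundedContinuousFunction.norm_ofNormedAddCommGroup_le _ (norm_nonneg f) _
  · have hn : (0 : ℝ) < 1 / ((n : ℝ) + 1) := by positivity
    refine ⟨2 * ‖f‖ / (1 / ((n : ℝ) + 1)), fun s hs t ht x => ?_⟩
    rw [hA_int _ hn s hs, hA_int _ hn t ht]
    exact abs_integral_comp_add_mul_sub_le (hu_time x) (fun r => hu_le r x) hn s t
  · have hA_cont : Continuous fun h : ℝ => A h x :=
      intervalIntegral.continuous_of_dominated_interval (bound := fun _ => ‖f‖)
        (fun h => ((hu_time x).comp (continuous_const_mul h)).aestronglyMeasurable)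
        (fun h => .of_forall fun s _ => hu_le _ _) (by simp)
        (.of_forall fun s _ => (hu_time x).comp (continuous_mul_const s))
    have h := (hA_cont.tendsto 0).comp (tendsto_one_div_add_atTop_nhds_zero_nat (𝕜 := ℝ))
    have h0 : A 0 x = f x := by simp [A, hu_zero]
    rwa [h0] at h

end Semigroup

/-- joint continuity of `(t, x) ↦ S(t)f(x)` for a Feller transition semigroup
satisfying compact containment and weak continuity. -/
theorem stmt_3
    {X : Type*} [TopologicalSpace X] [PolishSpace X]
    [MeasurableSpace X] [BorelSpace X]
    (κ : ℝ → X → Measure X)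
    (hmeas : ∀ t, Measurable (κ t))
    (hprob : ∀ t x, IsProbabilityMeasure (κ t x))
    (hzero : ∀ x, κ 0 x = Measure.dirac x)
    (hsemi : ∀ t ≥ (0:ℝ), ∀ s ≥ (0:ℝ), ∀ x, κ (t + s) x = (κ t x).bind (κ s))
    (hfeller : ∀ f : BoundedContinuousFunction X ℝ, ∀ t ≥ (0:ℝ),
      Continuous (fun x => ∫ y, f y ∂(κ t x)))
    (hcc : ∀ T > (0:ℝ), ∀ K : Set X, IsCompact K → ∀ ε > (0:ℝ),
      ∃ K' : Set X, IsCompact K' ∧ ∀ x ∈ K, ∀ t ∈ Set.Icc (0:ℝ) T,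
        ENNReal.ofReal (1 - ε) ≤ κ t x K')
    (hweak : ∀ μ : Measure X, IsProbabilityMeasure μ →
      ∀ f : BoundedContinuousFunction X ℝ,
        ContinuousOn (fun t => ∫ x, (∫ y, f y ∂(κ t x)) ∂μ) (Set.Ici 0)) :
    ∀ f : BoundedContinuousFunction X ℝ,
      ContinuousOn (fun p : ℝ × X => ∫ y, f y ∂(κ p.1 p.2))
        (Set.Ici (0:ℝ) ×ˢ Set.univ) := by
  intro f
  rintro ⟨t₀, x₀⟩ ⟨ht₀ : 0 ≤ t₀, -⟩
  have hcont (x : X) : ContinuousOn (fun t => ∫ y, f y ∂(κ t x)) (Set.Ici 0) := by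
    simpa using hweak (Measure.dirac x) inferInstance f
  obtain ⟨F, hF, hFlim⟩ := exists_seq_lipschitzOrbit_tendsto hmeas hprob hzero hsemi f
    (hfeller f) hcont
  rw [ContinuousWithinAt, tendsto_iff_seq_tendsto]
  intro p hp
  obtain ⟨hp, hp_mem⟩ := tendsto_nhdsWithin_iff.1 hp
  have hp₁ : Tendsto (fun n => (p n).1) atTop (𝓝 t₀) := (continuous_fst.tendsto _).comp hp
  have hp₂ : Tendsto (fun n => (p n).2) atTop (𝓝 x₀) := (continuous_snd.tendsto _).comp hp
  have hM := norm_nonneg f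
  rw [Metric.tendsto_nhds]
  intro δ hδ
  obtain ⟨ε, hε, hεδ⟩ : ∃ ε > 0, 2 * (ε + 2 * ‖f‖ * ε) = δ / 2 :=
    ⟨δ / (4 * (1 + 2 * ‖f‖)), by positivity, by field_simp; ring⟩
  obtain ⟨K', hK', hκ⟩ := hcc (t₀ + 1) (by linarith) _ hp₂.isCompact_insert_range ε hε
  obtain ⟨g, ⟨hg, L, hL⟩, hgf⟩ := exists_mem_convex_forall_abs_sub_lt
    (convex_lipschitzOrbit hprob ‖f‖) hF (fun n => (hF n).1) hFlim hK' hε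
  have hclose (t : ℝ) (ht : t ∈ Set.Icc 0 (t₀ + 1)) (x : X)
      (hx : x ∈ insert x₀ (Set.range fun n => (p n).2)) :
      |∫ y, g y ∂(κ t x) - ∫ y, f y ∂(κ t x)| ≤ ε + 2 * ‖f‖ * ε := by
    have := hprob t x
    exact abs_integral_sub_integral_le le_rfl hg hε.le hK'.measurableSet
      (fun y hy => (hgf y hy).le) (hκ x hx t ht)
  have hlim : Tendsto (fun n => L * |(p n).1 - t₀| +
      |∫ y, g y ∂(κ t₀ (p n).2) - ∫ y, g y ∂(κ t₀ x₀)|) atTop (𝓝 0) := by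
    have h1 := ((hp₁.sub_const t₀).abs).const_mul L
    have h2 := (((((hfeller g t₀ ht₀).tendsto x₀).comp hp₂).sub_const
      (∫ y, g y ∂(κ t₀ x₀))).abs)
    simpa using h1.add h2
  filter_upwards [hp_mem, hlim.eventually_lt_const (half_pos hδ),
    hp₁.eventually_lt_const (lt_add_one t₀)] with n hn hn_lim hn_lt
  have hn₀ : 0 ≤ (p n).1 := hn.1
  have h1 := hclose (p n).1 ⟨hn₀, hn_lt.le⟩ (p n).2 (.inr ⟨n, rfl⟩)
  have h2 := hclose t₀ ⟨ht₀, by linarith⟩ x₀ (.inl rfl)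
  have h3 := hL (p n).1 hn₀ t₀ ht₀ (p n).2
  rw [abs_sub_comm] at h1
  rw [Function.comp_apply, Real.dist_eq]
  have h4 := abs_sub_le (∫ y, f y ∂(κ (p n).1 (p n).2)) (∫ y, g y ∂(κ (p n).1 (p n).2))
    (∫ y, f y ∂(κ t₀ x₀))
  have h5 := abs_sub_le (∫ y, g y ∂(κ (p n).1 (p n).2)) (∫ y, g y ∂(κ t₀ (p n).2))
    (∫ y, f y ∂(κ t₀ x₀))
  have h6 := abs_sub_le (∫ y, g y ∂(κ t₀ (p n).2)) (∫ y, g y ∂(κ t₀ x₀))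
    (∫ y, f y ∂(κ t₀ x₀))
  linarith
end

section
/- Let X be a locally compact Polish space and (κ_t)_{t≥0} a semigroup of Markov kernels on X (κ_0(x,·) = δ_x and κ_{t+s} = κ_t κ_s) such that for every t ≥ 0 the operator S(t)f(x) := ∫ f dκ_t(x,·) maps C_0(X) into C_0(X). Assume weak continuity: for every finite Borel measure μ on X and every f ∈ C_0(X), the map t ↦ ∫_X (S(t)f)(x) μ(dx) is continuous on [0,∞). Then the restricted semigroup is strongly continuous on (C_0(X), ‖·‖_∞): for every f ∈ C_0(X), the map t ↦ S(t)f is continuous from [0,∞) to C_0(X) in supremum norm. (First statement of Theorem 4.1, with the β-continuity and β-strong continuity hypotheses expressed through the Markov kernel and weak-continuity assumptions.) -/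
open MeasureTheory Filter Topology
open scoped ZeroAtInfty CompactlySupported

theorem ZeroAtInftyContinuousMap.norm_le_of_forall {X : Type*} [TopologicalSpace X] (f : C₀(X, ℝ))
    {C : ℝ} (hC : 0 ≤ C) (h : ∀ x, |f x| ≤ C) : ‖f‖ ≤ C := by
  rw [← norm_toBCF_eq_norm]
  exact (BoundedContinuousFunction.norm_le hC).2 h

theorem ZeroAtInftyContinuousMap.norm_apply_le_norm {X : Type*} [TopologicalSpace X] (f : C₀(X, ℝ))
    (x : X) : ‖f x‖ ≤ ‖f‖ := by
  rw [← norm_toBCF_eq_norm]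
  exact f.toBCF.norm_coe_le_norm x

theorem ZeroAtInftyContinuousMap.integrable {X : Type*} [TopologicalSpace X] [MeasurableSpace X]
    [OpensMeasurableSpace X] (f : C₀(X, ℝ)) (μ : Measure X) [IsFiniteMeasure μ] :
    Integrable f μ :=
  Integrable.of_bound (map_continuous f).aestronglyMeasurable ‖f‖ (ae_of_all _ f.norm_apply_le_norm)

/-- A positive continuous functional on `C₀(X, ℝ)` is dominated, on nonnegative functions, by
integration against a finite measure. -/
theorem exists_isFiniteMeasure_le_integral {X : Type*} [TopologicalSpace X] [T2Space X]
    [LocallyCompactSpace X] [MeasurableSpace X] [BorelSpace X] (L : StrongDual ℝ C₀(X, ℝ))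
    (hL : ∀ u : C₀(X, ℝ), (∀ x, 0 ≤ u x) → 0 ≤ L u) :
    ∃ μ : Measure X, IsFiniteMeasure μ ∧
      ∀ w : C₀(X, ℝ), (∀ x, 0 ≤ w x) → L w ≤ ∫ x, w x ∂μ := by
  let Λ : C_c(X, ℝ) →ₚ[ℝ] ℝ := PositiveLinearMap.mk₀
    { toFun := fun u => L (u : C₀(X, ℝ))
      map_add' := fun u v => by rw [← map_add]; rfl
      map_smul' := fun c u => by rw [← map_smul]; rfl }
    (fun u hu => hL _ fun x => hu x)
  have hΛ : ∀ u : C_c(X, ℝ), Λ u = L (u : C₀(X, ℝ)) := fun u => rfl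
  have hfin : IsFiniteMeasure (RealRMK.rieszMeasure Λ) := by
    refine ⟨lt_of_le_of_lt ?_ (ENNReal.ofReal_lt_top (r := ‖L‖))⟩
    rw [isOpen_univ.measure_eq_iSup_isCompact]
    refine iSup₂_le fun K _ => iSup_le fun hK => ?_
    obtain ⟨u, hu1, -, huc, hu⟩ :=
      exists_continuous_one_zero_of_isCompact hK isClosed_empty (Set.disjoint_empty K)
    let v : C_c(X, ℝ) := ⟨u, huc⟩
    refine (RealRMK.rieszMeasure_le_of_eq_one Λ (f := v) (fun x => (hu x).1) hK
      (fun x hx => hu1 hx)).trans (ENNReal.ofReal_le_ofReal ?_)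
    have hv : ‖(v : C₀(X, ℝ))‖ ≤ 1 :=
      ZeroAtInftyContinuousMap.norm_le_of_forall _ zero_le_one fun x =>
        abs_le.2 ⟨by linarith [(hu x).1, show (v : C₀(X, ℝ)) x = u x from rfl], (hu x).2⟩
    calc Λ v ≤ ‖L (v : C₀(X, ℝ))‖ := le_abs_self _
      _ ≤ ‖L‖ * ‖(v : C₀(X, ℝ))‖ := L.le_opNorm _
      _ ≤ ‖L‖ := mul_le_of_le_one_right (norm_nonneg L) hv
  refine ⟨RealRMK.rieszMeasure Λ, hfin, fun w hw => ?_⟩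
  refine le_of_forall_pos_le_add fun ε hε => ?_
  obtain ⟨δ, hδ, hδε⟩ : ∃ δ > 0, ‖L‖ * δ ≤ ε :=
    ⟨ε / (‖L‖ + 1), by positivity, by
      rw [mul_div_assoc', div_le_iff₀ (by positivity)]
      nlinarith [norm_nonneg L]⟩
  have hcs : HasCompactSupport fun x => max (w x - δ) 0 := by
    have h := w.zero_at_infty'.eventually (gt_mem_nhds hδ)
    rw [Filter.Eventually, Filter.mem_cocompact] at h
    obtain ⟨K, hK, hKs⟩ := h
    refine HasCompactSupport.intro hK fun x hx => max_eq_right ?_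
    have : w x < δ := hKs hx
    linarith
  let v : C_c(X, ℝ) := ⟨⟨fun x => max (w x - δ) 0, by fun_prop⟩, hcs⟩
  have hv : ∀ x, v x = max (w x - δ) 0 := fun x => rfl
  have hv' : ∀ x, (v : C₀(X, ℝ)) x = max (w x - δ) 0 := fun x => rfl
  have hwv : ‖w - (v : C₀(X, ℝ))‖ ≤ δ := by
    refine ZeroAtInftyContinuousMap.norm_le_of_forall _ hδ.le fun x => ?_
    rw [ZeroAtInftyContinuousMap.sub_apply, hv', abs_le]
    have := hw x
    rcases max_cases (w x - δ) 0 with ⟨h, _⟩ | ⟨h, _⟩ <;> rw [h] <;> constructor <;> linarith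
  calc L w = L (w - (v : C₀(X, ℝ))) + Λ v := by rw [hΛ, ← map_add, sub_add_cancel]
    _ ≤ ε + ∫ x, v x ∂(RealRMK.rieszMeasure Λ) := by
      rw [RealRMK.integral_rieszMeasure]
      gcongr
      exact (le_abs_self _).trans ((L.le_opNorm _).trans
        ((mul_le_mul_of_nonneg_left hwv (norm_nonneg _)).trans hδε))
    _ ≤ ε + ∫ x, w x ∂(RealRMK.rieszMeasure Λ) := by
      gcongr
      · exact (v : C₀(X, ℝ)).integrable _
      · exact w.integrable _
      · intro x
        exact max_le (by linarith) (hw x)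
    _ = _ := add_comm _ _

/-- A bounded pointwise limit of elements of a subspace of `C₀(X, ℝ)` lies in its norm closure. -/
theorem Submodule.mem_closure_of_tendsto_pointwise {X : Type*} [TopologicalSpace X] [T2Space X]
    [LocallyCompactSpace X] [MeasurableSpace X] [BorelSpace X] (V : Submodule ℝ C₀(X, ℝ))
    {F : ℕ → C₀(X, ℝ)} (hF : ∀ n, F n ∈ V) {C : ℝ} (hC : ∀ n x, |F n x| ≤ C) {f : C₀(X, ℝ)}
    (hlim : ∀ x, Tendsto (fun n => F n x) atTop (𝓝 (f x))) :
    f ∈ closure (V : Set C₀(X, ℝ)) := by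
  by_contra hf
  rw [Metric.mem_closure_iff] at hf
  push Not at hf
  obtain ⟨ε, hε, hf⟩ := hf
  let A : Set C₀(X, ℝ) := {u | ∃ g ∈ V, ∀ x, |g x - f x| ≤ u x}
  have hA : Convex ℝ A := by
    rintro u ⟨g, hg, hgu⟩ v ⟨h, hh, hhv⟩ a b ha hb hab
    refine ⟨a • g + b • h, V.add_mem (V.smul_mem a hg) (V.smul_mem b hh), fun x => ?_⟩
    have h1 := mul_le_mul_of_nonneg_left (hgu x) ha
    have h2 := mul_le_mul_of_nonneg_left (hhv x) hb
    have h3 : (a • g + b • h) x - f x = a * (g x - f x) + b * (h x - f x) := by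
      simp only [ZeroAtInftyContinuousMap.add_apply, ZeroAtInftyContinuousMap.smul_apply,
        smul_eq_mul]
      linear_combination (f x) * hab
    rw [h3]
    refine (abs_add_le _ _).trans ?_
    rw [abs_mul, abs_mul, abs_of_nonneg ha, abs_of_nonneg hb]
    exact add_le_add h1 h2
  have hdisj : Disjoint (Metric.ball (0 : C₀(X, ℝ)) ε) A := by
    refine Set.disjoint_left.2 fun u hu => ?_
    rintro ⟨g, hg, hgu⟩
    refine (hf g hg).not_gt ?_
    rw [dist_comm, dist_eq_norm]
    refine lt_of_le_of_lt ?_ (mem_ball_zero_iff.1 hu)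
    exact ZeroAtInftyContinuousMap.norm_le_of_forall _ (norm_nonneg _) fun x =>
      (hgu x).trans ((le_abs_self _).trans (u.norm_apply_le_norm x))
  obtain ⟨L, c, hLb, hLA⟩ :=
    geometric_hahn_banach_open (convex_ball _ _) Metric.isOpen_ball hA hdisj
  have hc : 0 < c := by simpa using hLb 0 (Metric.mem_ball_self hε)
  let w : C₀(X, ℝ) → C₀(X, ℝ) := fun g =>
    ⟨⟨fun x => |g x - f x|, by fun_prop⟩, by simpa using (g - f).zero_at_infty'.abs⟩
  have hw : ∀ g x, w g x = |g x - f x| := fun g x => rfl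
  have hwA : ∀ g ∈ V, w g ∈ A := fun g hg => ⟨g, hg, fun x => le_rfl⟩
  have hpos : ∀ u : C₀(X, ℝ), (∀ x, 0 ≤ u x) → 0 ≤ L u := by
    intro u hu
    by_contra! hneg
    obtain ⟨n, hn⟩ := exists_nat_gt (L (w 0) / -L u)
    rw [div_lt_iff₀ (by linarith)] at hn
    have h := hLA (w 0 + (n : ℝ) • u) ⟨0, V.zero_mem, fun x => by
      have : 0 ≤ (n : ℝ) * u x := mul_nonneg n.cast_nonneg (hu x)
      simpa [hw] using this⟩
    rw [map_add, map_smul, smul_eq_mul] at h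
    linarith
  obtain ⟨μ, _, hμ⟩ := exists_isFiniteMeasure_le_integral L hpos
  have hlim0 : Tendsto (fun n => ∫ x, w (F n) x ∂μ) atTop (𝓝 (∫ _, (0 : ℝ) ∂μ)) := by
    refine tendsto_integral_of_dominated_convergence (fun _ => C + ‖f‖)
      (fun n => ((w (F n)).integrable μ).aestronglyMeasurable) (integrable_const _) (fun n => ae_of_all _ fun x => ?_)
      (ae_of_all _ fun x => ?_)
    · rw [hw, Real.norm_eq_abs, abs_abs]
      exact (abs_sub _ _).trans (add_le_add (hC n x) (f.norm_apply_le_norm x))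
    · simpa [hw] using ((hlim x).sub_const (f x)).abs
  rw [integral_zero] at hlim0
  refine hc.not_ge (ge_of_tendsto' hlim0 fun n => ?_)
  exact (hLA _ (hwA _ (hF n))).trans (hμ _ fun x => abs_nonneg _)

theorem isCountablyGenerated_cocompact {X : Type*} [TopologicalSpace X] [SigmaCompactSpace X]
    [WeaklyLocallyCompactSpace X] : (cocompact X).IsCountablyGenerated := by
  let K : CompactExhaustion X := default
  refine HasBasis.isCountablyGenerated (p := fun _ : ℕ => True) (s := fun n => (K n)ᶜ)
    ⟨fun t => ?_⟩
  rw [mem_cocompact]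
  constructor
  · rintro ⟨s, hs, hst⟩
    obtain ⟨n, hn⟩ := K.exists_superset_of_isCompact hs
    exact ⟨n, trivial, (Set.compl_subset_compl.2 hn).trans hst⟩
  · rintro ⟨n, -, hn⟩
    exact ⟨K n, K.isCompact n, hn⟩

/-- The pointwise integral of a bounded, pointwise continuous curve in `C₀(X, ℝ)` is again in
`C₀(X, ℝ)`. -/
theorem ZeroAtInftyContinuousMap.exists_eq_intervalIntegral {X : Type*} [TopologicalSpace X]
    [FirstCountableTopology X] [SigmaCompactSpace X] [WeaklyLocallyCompactSpace X]
    {u : ℝ → C₀(X, ℝ)} {C : ℝ} (hC : ∀ s x, |u s x| ≤ C)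
    (hu : ∀ x, Continuous fun s => u s x) (a b : ℝ) :
    ∃ g : C₀(X, ℝ), ∀ x, g x = ∫ s in a..b, u s x := by
  have := isCountablyGenerated_cocompact (X := X)
  refine ⟨⟨⟨fun x => ∫ s in a..b, u s x, ?_⟩, ?_⟩, fun x => rfl⟩
  · exact intervalIntegral.continuous_of_dominated_interval (bound := fun _ => C)
      (fun x => (hu x).aestronglyMeasurable) (fun x => ae_of_all _ fun s _ => hC s x)
      intervalIntegrable_const (ae_of_all _ fun s _ => map_continuous (u s))
  · have h := intervalIntegral.tendsto_integral_filter_of_dominated_convergence (μ := volume)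
      (a := a) (b := b) (l := cocompact X) (F := fun x s => u s x) (f := fun _ => (0 : ℝ))
      (fun _ => C)
      (Eventually.of_forall fun x => (hu x).aestronglyMeasurable)
      (Eventually.of_forall fun x => ae_of_all _ fun s _ => hC s x)
      intervalIntegrable_const (ae_of_all _ fun s _ => (u s).zero_at_infty')
    simpa using h

/-- A pointwise continuous semigroup of probability averages on `C₀(X, ℝ)` is strongly continuous
at zero. -/
theorem ZeroAtInftyContinuousMap.tendsto_semigroup_zero {X : Type*} [TopologicalSpace X]
    [T2Space X] [LocallyCompactSpace X] [FirstCountableTopology X] [SigmaCompactSpace X]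
    [MeasurableSpace X] [BorelSpace X] (ν : ℝ → X → Measure X)
    (hν : ∀ t x, IsProbabilityMeasure (ν t x)) (T : ℝ → C₀(X, ℝ) → C₀(X, ℝ))
    (hT : ∀ t f x, T t f x = ∫ y, f y ∂(ν t x)) (hzero : ∀ f, T 0 f = f)
    (hadd : ∀ t ≥ 0, ∀ s ≥ 0, ∀ f, T (t + s) f = T t (T s f))
    (hcont : ∀ f x, Continuous fun t => T t f x) (f : C₀(X, ℝ)) :
    Tendsto (fun t => T t f) (𝓝[≥] 0) (𝓝 f) := by
  have hTadd : ∀ t f g, T t (f + g) = T t f + T t g := fun t f g => by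
    ext x
    simpa only [add_apply, hT] using integral_add (f.integrable (ν t x)) (g.integrable _)
  have hTsmul : ∀ t (c : ℝ) f, T t (c • f) = c • T t f := fun t c f => by
    ext x
    simpa only [smul_apply, hT] using integral_smul c f
  have hTsub : ∀ t f g, T t (f - g) = T t f - T t g := fun t f g => by
    ext x
    simpa only [sub_apply, hT] using integral_sub (f.integrable (ν t x)) (g.integrable _)
  have hcontr : ∀ t f, ‖T t f‖ ≤ ‖f‖ := fun t f =>
    norm_le_of_forall _ (norm_nonneg _) fun x => by
      rw [hT]
      simpa using norm_integral_le_of_norm_le_const (ae_of_all (ν t x) f.norm_apply_le_norm)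
  let V : Submodule ℝ C₀(X, ℝ) :=
    { carrier := {g | Tendsto (fun t => T t g) (𝓝[≥] 0) (𝓝 g)}
      add_mem' := fun {f g} hf hg => by
        simpa only [Set.mem_ofPred_eq, hTadd] using Tendsto.add hf hg
      zero_mem' := by
        have : ∀ t, T t 0 = 0 := fun t => by simpa using hTsmul t 0 0
        simpa only [Set.mem_ofPred_eq, this] using tendsto_const_nhds
      smul_mem' := fun c f hf => by
        simpa only [Set.mem_ofPred_eq, hTsmul] using Tendsto.const_smul hf c }
  have hbound : ∀ s x, ‖T s f x‖ ≤ ‖f‖ := fun s x =>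
    ((T s f).norm_apply_le_norm x).trans (hcontr s f)
  choose G hG using fun h : ℝ => exists_eq_intervalIntegral hbound (hcont f) 0 h
  have hii : ∀ x a b, IntervalIntegrable (fun s => T s f x) volume a b := fun x a b =>
    (hcont f x).intervalIntegrable a b
  have hshift : ∀ h ≥ 0, ∀ t ≥ 0, ∀ x, T t (G h) x = ∫ s in t..t + h, T s f x := by
    intro h hh t ht x
    have hmeas : Measurable (Function.uncurry fun s y => T s f y) :=
      measurable_uncurry_of_continuous_of_measurable (hcont f)
        fun s => (map_continuous (T s f)).measurable
    have := hν t x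
    have : IsFiniteMeasure (volume.restrict (Set.uIoc 0 h)) := by
      rw [Set.uIoc_of_le hh]
      infer_instance
    have hint : Integrable (Function.uncurry fun s y => T s f y)
        ((volume.restrict (Set.uIoc 0 h)).prod (ν t x)) :=
      Integrable.of_bound hmeas.aestronglyMeasurable ‖f‖ (ae_of_all _ fun p => hbound p.1 p.2)
    calc T t (G h) x = ∫ y, (∫ s in 0..h, T s f y) ∂(ν t x) := by simp only [hT t, hG]
      _ = ∫ s in 0..h, T (t + s) f x := by
        rw [← intervalIntegral_integral_swap hint]
        refine intervalIntegral.integral_congr fun s hs => ?_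
        rw [Set.uIcc_of_le hh] at hs
        simp only [hadd t ht s hs.1, hT t]
      _ = ∫ s in t..t + h, T s f x := by
        rw [intervalIntegral.integral_comp_add_left (fun s => T s f x) t, add_zero]
  have hGV : ∀ h ≥ 0, G h ∈ V := by
    intro h hh
    change Tendsto (fun t => T t (G h)) (𝓝[≥] 0) (𝓝 (G h))
    rw [tendsto_iff_norm_sub_tendsto_zero]
    have hlim : Tendsto (fun t : ℝ => 2 * ‖f‖ * t) (𝓝[≥] 0) (𝓝 0) := by
      have : Continuous fun t : ℝ => 2 * ‖f‖ * t := by fun_prop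
      simpa using (this.tendsto 0).mono_left nhdsWithin_le_nhds
    refine squeeze_zero' (Eventually.of_forall fun t => norm_nonneg _) ?_ hlim
    filter_upwards [self_mem_nhdsWithin] with t (ht : 0 ≤ t)
    refine norm_le_of_forall _ (by positivity) fun x => ?_
    rw [sub_apply, hshift h hh t ht, hG, intervalIntegral.integral_interval_sub_interval_comm'
      (hii _ _ _) (hii _ _ _) (hii _ _ _)]
    have h1 := intervalIntegral.norm_integral_le_of_norm_le_const (a := h) (b := t + h)
      fun s _ => hbound s x
    have h2 := intervalIntegral.norm_integral_le_of_norm_le_const (a := 0) (b := t)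
      fun s _ => hbound s x
    rw [add_sub_cancel_right, abs_of_nonneg ht, Real.norm_eq_abs] at h1
    rw [sub_zero, abs_of_nonneg ht, Real.norm_eq_abs] at h2
    exact (abs_sub _ _).trans (by linarith)
  have hderiv : ∀ x, Tendsto (fun n : ℕ => ((1 / ((n : ℝ) + 1))⁻¹ • G (1 / ((n : ℝ) + 1))) x)
      atTop (𝓝 (f x)) := by
    intro x
    have hd := (intervalIntegral.integral_hasDerivAt_right (hii x 0 0)
      ((hcont f x).stronglyMeasurableAtFilter _ _) (hcont f x).continuousAt).tendsto_slope_zero_right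
    have hn : Tendsto (fun n : ℕ => 1 / ((n : ℝ) + 1)) atTop (𝓝[>] 0) :=
      tendsto_nhdsWithin_iff.2 ⟨tendsto_one_div_add_atTop_nhds_zero_nat,
        Eventually.of_forall fun n => Set.mem_Ioi.2 Nat.one_div_pos_of_nat⟩
    have := hd.comp hn
    simpa only [Function.comp_def, zero_add, intervalIntegral.integral_same, sub_zero, smul_apply,
      hG, hzero] using this
  have hclosure : f ∈ closure (V : Set C₀(X, ℝ)) := by
    refine V.mem_closure_of_tendsto_pointwise (C := ‖f‖)
      (fun n => V.smul_mem _ (hGV _ (by positivity))) (fun n x => ?_) hderiv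
    have hp : (0 : ℝ) < 1 / ((n : ℝ) + 1) := by positivity
    have h := intervalIntegral.norm_integral_le_of_norm_le_const (a := 0) (b := 1 / ((n : ℝ) + 1))
      fun s _ => hbound s x
    rw [sub_zero, abs_of_pos hp, Real.norm_eq_abs] at h
    rw [smul_apply, hG, smul_eq_mul, abs_mul, abs_of_pos (inv_pos.2 hp), inv_mul_le_iff₀ hp]
    linarith
  rw [Metric.tendsto_nhds]
  intro ε hε
  obtain ⟨g, hg, hfg⟩ := Metric.mem_closure_iff.1 hclosure (ε / 3) (by positivity)
  filter_upwards [Metric.tendsto_nhds.1 (show Tendsto _ _ _ from hg) (ε / 3) (by positivity)]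
    with t ht
  have h1 : dist (T t f) (T t g) ≤ dist f g := by
    rw [dist_eq_norm, dist_eq_norm, ← hTsub]
    exact hcontr t _
  have h2 := dist_triangle4 (T t f) (T t g) g f
  rw [dist_comm g f] at h2
  linarith

/-- a weakly continuous Markov transition semigroup that preserves `C₀(X)` is
strongly continuous on `(C₀(X), ‖·‖_∞)`. -/
theorem stmt_4
    {X : Type*} [TopologicalSpace X] [PolishSpace X] [LocallyCompactSpace X]
    [MeasurableSpace X] [BorelSpace X]
    (κ : ℝ → X → Measure X)
    (hmeas : ∀ t, Measurable (κ t))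
    (hprob : ∀ t x, IsProbabilityMeasure (κ t x))
    (hzero : ∀ x, κ 0 x = Measure.dirac x)
    (hsemi : ∀ t ≥ (0:ℝ), ∀ s ≥ (0:ℝ), ∀ x, κ (t + s) x = (κ t x).bind (κ s))
    (hC0 : ∀ t ≥ (0:ℝ), ∀ f : ZeroAtInftyContinuousMap X ℝ,
      ∃ g : ZeroAtInftyContinuousMap X ℝ, ∀ x, (∫ y, f y ∂(κ t x)) = g x)
    (hweak : ∀ μ : Measure X, IsFiniteMeasure μ → ∀ f : ZeroAtInftyContinuousMap X ℝ,
      ContinuousOn (fun t => ∫ x, (∫ y, f y ∂(κ t x)) ∂μ) (Set.Ici 0)) :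
    ∀ f : ZeroAtInftyContinuousMap X ℝ, ∀ t ∈ Set.Ici (0:ℝ),
      Tendsto (fun s => ⨆ x, |(∫ y, f y ∂(κ s x)) - ∫ y, f y ∂(κ t x)|)
        (nhdsWithin t (Set.Ici 0)) (nhds 0) := by
  intro f t ht
  choose T hT' using fun t : ℝ => hC0 (max t 0) (le_max_right t 0)
  have hT : ∀ t f x, T t f x = ∫ y, f y ∂(κ (max t 0) x) := fun t f x => (hT' t f x).symm
  have hTnonneg : ∀ t ≥ 0, ∀ f x, T t f x = ∫ y, f y ∂(κ t x) := fun t ht f x => by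
    rw [hT, max_eq_left ht]
  have hT0 : ∀ f, T 0 f = f := fun f => by
    ext x
    rw [hTnonneg 0 le_rfl, hzero, integral_dirac]
  have hadd : ∀ t ≥ 0, ∀ s ≥ 0, ∀ f, T (t + s) f = T t (T s f) := by
    intro t ht s hs f
    ext x
    let η : ProbabilityTheory.Kernel X X := ⟨κ s, hmeas s⟩
    let θ : ProbabilityTheory.Kernel X X := ⟨κ t, hmeas t⟩
    have hηθ : ProbabilityTheory.Kernel.comp η θ x = κ (t + s) x := (hsemi t ht s hs x).symm
    have h := ProbabilityTheory.Kernel.integral_comp (η := η) (κ := θ) (a := x) (f := f)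
      (by rw [hηθ]; exact f.integrable _)
    rw [hTnonneg (t + s) (add_nonneg ht hs), hTnonneg t ht, ← hηθ]
    simp only [hTnonneg s hs]
    exact h
  have hcont : ∀ f x, Continuous fun t => T t f x := by
    intro f x
    have h : ContinuousOn (fun t => T t f x) (Set.Ici 0) := by
      refine (hweak (Measure.dirac x) inferInstance f).congr fun t ht => ?_
      simp only [← hTnonneg t ht f, integral_dirac]
    have h2 := h.comp_continuous (f := fun t : ℝ => max t 0) (by fun_prop)
      fun t => le_max_right t 0
    simpa only [Function.comp_def, hT, max_assoc, max_self] using h2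
  have hstrong := ZeroAtInftyContinuousMap.tendsto_semigroup_zero (fun t => κ (max t 0))
    (fun t x => hprob _ x) T hT hT0 hadd hcont f
  rw [tendsto_iff_norm_sub_tendsto_zero] at hstrong
  have hincr : ∀ a ≥ 0, ∀ b ≥ 0, a ≤ b → ∀ x, |T b f x - T a f x| ≤ ‖T (b - a) f - f‖ := by
    intro a ha b hb hab x
    rw [show T b f = T a (T (b - a) f) by rw [← hadd a ha _ (sub_nonneg.2 hab), add_sub_cancel],
      hTnonneg a ha, hTnonneg a ha, ← integral_sub ((T (b - a) f).integrable _) (f.integrable _)]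
    have := norm_integral_le_of_norm_le_const
      (ae_of_all (κ a x) (T (b - a) f - f).norm_apply_le_norm)
    simpa using this
  have habs : Tendsto (fun s => |s - t|) (𝓝[Set.Ici 0] t) (𝓝[≥] 0) := by
    refine tendsto_nhdsWithin_iff.2 ⟨?_, Eventually.of_forall fun s => Set.mem_Ici.2 (abs_nonneg _)⟩
    have : Continuous fun s => |s - t| := by fun_prop
    simpa using (this.tendsto t).mono_left nhdsWithin_le_nhds
  refine squeeze_zero' (Eventually.of_forall fun s => Real.iSup_nonneg fun x => abs_nonneg _) ?_
    (hstrong.comp habs)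
  filter_upwards [self_mem_nhdsWithin] with s hs
  refine Real.iSup_le (fun x => ?_) (norm_nonneg _)
  rw [← hTnonneg s hs, ← hTnonneg t ht]
  rcases le_total t s with h | h
  · simpa only [Function.comp_def, abs_of_nonneg (sub_nonneg.2 h)] using hincr t ht s hs h x
  · rw [abs_sub_comm]
    simpa only [Function.comp_def, abs_of_nonpos (sub_nonpos.2 h), neg_sub] using
      hincr s hs t ht h x
end

section
/- Let X be a locally compact Polish space and (κ_t)_{t≥0} a semigroup of Markov kernels on X (κ_0(x,·) = δ_x and κ_{t+s} = κ_t κ_s) such that the maps S(t)f(x) := ∫ f dκ_t(x,·) send C_0(X) into C_0(X) and (S(t))_{t≥0} is strongly continuous on (C_0(X), ‖·‖_∞). Then for every f ∈ C_b(X) there exist sequences (f_n) and (g_n) in C_0(X) such that: (i) ‖f_n‖_∞ ≤ ‖f‖_∞ for all n; (ii) f_n → f uniformly on every compact subset of X; and (iii) for each n, ‖t^{-1}(S(t)f_n − f_n) − g_n‖_∞ → 0 as t ↓ 0 (i.e. each f_n lies in the domain of the norm-generator of the restricted semigroup on C_0(X)). (This is a concrete form of the third statement of Theorem 4.1: the domain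 of the C_0(X)-generator is a core for the strict-topology generator on C_b(X).) -/
open MeasureTheory Filter Topology

open scoped NNReal ZeroAtInfty

section ContractionSemigroup

variable {E : Type*} [NormedAddCommGroup E] [NormedSpace ℝ E] {S : ℝ≥0 → E →L[ℝ] E}

/-- The orbits of a contraction semigroup are continuous as soon as they are continuous at `0`. -/
theorem continuous_orbit_of_contraction_semigroup
    (hadd : ∀ t s e, S (t + s) e = S t (S s e)) (hnorm : ∀ t e, ‖S t e‖ ≤ ‖e‖)
    {e : E} (hcont : Tendsto (fun t => S t e) (𝓝 0) (𝓝 e)) : Continuous fun t => S t e := by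
  have key : ∀ t s : ℝ≥0, s ≤ t → dist (S t e) (S s e) ≤ dist (S (t - s + (s - t)) e) e := by
    intro t s hst
    obtain ⟨d, rfl⟩ := exists_add_of_le hst
    have hd : s + d - s + (s - (s + d)) = d := by
      rw [add_tsub_cancel_left, tsub_eq_zero_of_le hst, add_zero]
    rw [hd, hadd, dist_eq_norm, dist_eq_norm, ← map_sub]
    exact hnorm _ _
  have key' : ∀ t s : ℝ≥0, dist (S t e) (S s e) ≤ dist (S (t - s + (s - t)) e) e := by
    intro t s
    rcases le_total s t with h | h
    · exact key t s h
    · rw [dist_comm, add_comm]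
      exact key s t h
  refine continuous_iff_continuousAt.2 fun s => tendsto_iff_dist_tendsto_zero.2 ?_
  have hsub : Tendsto (fun t : ℝ≥0 => t - s + (s - t)) (𝓝 s) (𝓝 0) := by
    have : Continuous fun t : ℝ≥0 => t - s + (s - t) := by fun_prop
    simpa using this.tendsto s
  exact squeeze_zero (fun _ => dist_nonneg) (fun t => key' t s)
    (tendsto_iff_dist_tendsto_zero.1 (hcont.comp hsub))

/-- Vectors in the domain of the generator of a strongly continuous contraction semigroup are
dense, with norm control. -/
theorem exists_mem_generator_domain_near [CompleteSpace E]
    (hzero : ∀ e, S 0 e = e) (hadd : ∀ t s e, S (t + s) e = S t (S s e))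
    (hnorm : ∀ t e, ‖S t e‖ ≤ ‖e‖) {e : E} (hcont : Tendsto (fun t => S t e) (𝓝 0) (𝓝 e))
    {ε : ℝ} (hε : 0 < ε) :
    ∃ F G : E, ‖F‖ ≤ ‖e‖ ∧ ‖F - e‖ < ε ∧
      Tendsto (fun t : ℝ => t⁻¹ • (S t.toNNReal F - F)) (𝓝[>] 0) (𝓝 G) := by
  set u : ℝ → E := fun t => S t.toNNReal e with hu_def
  have hu : Continuous u :=
    (continuous_orbit_of_contraction_semigroup hadd hnorm hcont).comp continuous_real_toNNReal
  have hint : ∀ a b, IntervalIntegrable u volume a b := fun a b => hu.intervalIntegrable a b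
  set I : ℝ → E := fun r => ∫ s in (0 : ℝ)..r, u s with hI
  have hderiv : ∀ r, HasDerivAt I (u r) r := fun r => (hu.integral_hasStrictDerivAt 0 r).hasDerivAt
  have hI0 : I 0 = 0 := intervalIntegral.integral_same
  have hlim : Tendsto (fun h : ℝ => h⁻¹ • I h) (𝓝[>] 0) (𝓝 e) := by
    simpa [hI0, hu_def, hzero] using (hderiv 0).tendsto_slope_zero_right
  obtain ⟨h, hclose, hpos⟩ :=
    ((hlim.eventually (Metric.ball_mem_nhds e hε)).and self_mem_nhdsWithin).exists
  replace hpos : 0 < h := hpos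
  refine ⟨h⁻¹ • I h, h⁻¹ • (u h - u 0), ?_, by simpa [dist_eq_norm] using hclose, ?_⟩
  · have hb : ‖I h‖ ≤ ‖e‖ * |h - 0| :=
      intervalIntegral.norm_integral_le_of_norm_le_const fun s _ => hnorm _ _
    rw [sub_zero, abs_of_pos hpos] at hb
    rw [norm_smul, norm_inv, Real.norm_of_nonneg hpos.le, inv_mul_le_iff₀ hpos, mul_comm]
    exact hb
  · have hshift : ∀ t : ℝ, 0 < t →
        t⁻¹ • (S t.toNNReal (h⁻¹ • I h) - h⁻¹ • I h) =
          h⁻¹ • (t⁻¹ • (I (h + t) - I h) - t⁻¹ • (I (0 + t) - I 0)) := by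
      intro t ht
      have hS : S t.toNNReal (I h) = I (h + t) - I t := by
        calc S t.toNNReal (I h) = ∫ s in (0 : ℝ)..h, S t.toNNReal (u s) :=
              ((S t.toNNReal).intervalIntegral_comp_comm (hint 0 h)).symm
          _ = ∫ s in (0 : ℝ)..h, u (s + t) := by
              refine intervalIntegral.integral_congr fun s hs => ?_
              rw [Set.uIcc_of_le hpos.le] at hs
              simp only [hu_def]
              rw [← hadd, add_comm s t, Real.toNNReal_add ht.le hs.1]
          _ = ∫ s in t..h + t, u s := by
              rw [intervalIntegral.integral_comp_add_right u t, zero_add]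
          _ = I (h + t) - I t :=
              (intervalIntegral.integral_interval_sub_left (hint 0 (h + t)) (hint 0 t)).symm
      rw [map_smul, hS, hI0, zero_add]
      module
    refine Tendsto.congr' (eventually_mem_nhdsWithin.mono fun t ht => (hshift t ht).symm) ?_
    exact ((hderiv h).tendsto_slope_zero_right.sub
      (hderiv 0).tendsto_slope_zero_right).const_smul h⁻¹

end ContractionSemigroup

namespace ZeroAtInftyContinuousMap

variable {X : Type*} [TopologicalSpace X]

theorem norm_eq_iSup_abs (f : C₀(X, ℝ)) : ‖f‖ = ⨆ x, |f x| := by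
  rw [← norm_toBCF_eq_norm, BoundedContinuousFunction.norm_eq_iSup_norm]
  rfl

theorem abs_apply_le_norm (f : C₀(X, ℝ)) (x : X) : |f x| ≤ ‖f‖ := by
  rw [← norm_toBCF_eq_norm]
  exact f.toBCF.norm_coe_le_norm x

theorem norm_le_of_abs_apply_le {f : C₀(X, ℝ)} {C : ℝ} (hC : 0 ≤ C) (h : ∀ x, |f x| ≤ C) :
    ‖f‖ ≤ C := by
  rw [← norm_toBCF_eq_norm]
  exact (BoundedContinuousFunction.norm_le hC).2 h

theorem integrable_of_isFiniteMeasure [MeasurableSpace X] [OpensMeasurableSpace X]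
    (f : C₀(X, ℝ)) (μ : Measure X) [IsFiniteMeasure μ] : Integrable f μ :=
  f.toBCF.integrable μ

/-- The operator on `C₀(X)` induced by a Markov kernel with the Feller property. -/
theorem exists_clm_integral [MeasurableSpace X] [OpensMeasurableSpace X]
    {κ : X → Measure X} (hprob : ∀ x, IsProbabilityMeasure (κ x))
    (hC0 : ∀ f : C₀(X, ℝ), ∃ g : C₀(X, ℝ), ∀ x, ∫ y, f y ∂(κ x) = g x) :
    ∃ T : C₀(X, ℝ) →L[ℝ] C₀(X, ℝ),
      (∀ f x, T f x = ∫ y, f y ∂(κ x)) ∧ ∀ f, ‖T f‖ ≤ ‖f‖ := by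
  choose g hg using hC0
  have hnorm : ∀ f, ‖g f‖ ≤ ‖f‖ := fun f => norm_le_of_abs_apply_le (norm_nonneg f) fun x => by
    rw [← hg]
    simpa using norm_integral_le_of_norm_le_const (μ := κ x)
      (Eventually.of_forall fun y => (Real.norm_eq_abs _).trans_le (f.abs_apply_le_norm y))
  let T : C₀(X, ℝ) →ₗ[ℝ] C₀(X, ℝ) :=
    { toFun := g
      map_add' := fun a b => by
        ext x
        rw [add_apply, ← hg, ← hg, ← hg]
        exact integral_add (a.integrable_of_isFiniteMeasure _) (b.integrable_of_isFiniteMeasure _)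
      map_smul' := fun c a => by
        ext x
        rw [RingHom.id_apply, smul_apply, ← hg, ← hg]
        exact integral_smul c _ }
  exact ⟨T.mkContinuous 1 fun f => (hnorm f).trans_eq (one_mul _).symm, fun f x => (hg f x).symm, hnorm⟩

end ZeroAtInftyContinuousMap

/-- Every bounded continuous function agrees on a given compact set with a function vanishing at
infinity whose norm is no larger. -/
theorem BoundedContinuousFunction.exists_zeroAtInfty_eqOn {X : Type*} [TopologicalSpace X]
    [RegularSpace X] [LocallyCompactSpace X] (f : BoundedContinuousFunction X ℝ) {K : Set X}
    (hK : IsCompact K) : ∃ g : C₀(X, ℝ), ‖g‖ ≤ ‖f‖ ∧ Set.EqOn g f K := by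
  obtain ⟨χ, h1, -, hsupp, hmem⟩ :=
    exists_continuous_one_zero_of_isCompact hK isClosed_empty (Set.disjoint_empty K)
  refine ⟨⟨χ * f.toContinuousMap, (hsupp.mul_right).is_zero_at_infty⟩, ?_, fun x hx => ?_⟩
  · refine ZeroAtInftyContinuousMap.norm_le_of_abs_apply_le (norm_nonneg f) fun x => ?_
    change |χ x * f x| ≤ ‖f‖
    rw [abs_mul, abs_of_nonneg (hmem x).1]
    exact (mul_le_of_le_one_left (abs_nonneg _) (hmem x).2).trans (f.norm_coe_le_norm x)
  · change χ x * f x = f x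
    rw [h1 hx, Pi.one_apply, one_mul]

/-- the domain of the `C₀(X)`-generator is a core for the strict-topology
generator: every `f ∈ C_b(X)` is a strict limit of a norm-dominated sequence in the domain
of the norm-generator of the restricted semigroup. -/
theorem stmt_8
    {X : Type*} [TopologicalSpace X] [PolishSpace X] [LocallyCompactSpace X]
    [MeasurableSpace X] [BorelSpace X]
    (κ : ℝ → X → Measure X)
    (hmeas : ∀ t, Measurable (κ t))
    (hprob : ∀ t x, IsProbabilityMeasure (κ t x))
    (hzero : ∀ x, κ 0 x = Measure.dirac x)
    (hsemi : ∀ t ≥ (0:ℝ), ∀ s ≥ (0:ℝ), ∀ x, κ (t + s) x = (κ t x).bind (κ s))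
    (hC0 : ∀ t ≥ (0:ℝ), ∀ f : ZeroAtInftyContinuousMap X ℝ,
      ∃ g : ZeroAtInftyContinuousMap X ℝ, ∀ x, (∫ y, f y ∂(κ t x)) = g x)
    (hsc : ∀ f : ZeroAtInftyContinuousMap X ℝ,
      Tendsto (fun t => ⨆ x, |(∫ y, f y ∂(κ t x)) - f x|)
        (nhdsWithin 0 (Set.Ioi 0)) (nhds 0)) :
    ∀ f : BoundedContinuousFunction X ℝ,
      ∃ F G : ℕ → ZeroAtInftyContinuousMap X ℝ,
        (∀ n, ‖F n‖ ≤ ‖f‖) ∧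
        (∀ K : Set X, IsCompact K →
          TendstoUniformlyOn (fun n x => F n x) (fun x => f x) atTop K) ∧
        (∀ n, Tendsto
          (fun t : ℝ => ⨆ x, |t⁻¹ * ((∫ y, F n y ∂(κ t x)) - F n x) - G n x|)
          (nhdsWithin 0 (Set.Ioi 0)) (nhds 0)) := by
  intro f
  choose S hS hnorm using fun t : ℝ≥0 =>
    ZeroAtInftyContinuousMap.exists_clm_integral (hprob t) (hC0 t t.coe_nonneg)
  have hS' : ∀ t : ℝ, 0 < t → ∀ (e : C₀(X, ℝ)) x, ∫ y, e y ∂(κ t x) = S t.toNNReal e x := by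
    intro t ht e x
    rw [hS, Real.coe_toNNReal t ht.le]
  have hS0 : ∀ e, S 0 e = e := by
    intro e
    ext x
    rw [hS, NNReal.coe_zero, hzero, integral_dirac]
  have hadd : ∀ t s e, S (t + s) e = S t (S s e) := by
    intro t s e
    ext x
    let k : ℝ≥0 → ProbabilityTheory.Kernel X X := fun r => ⟨κ r, hmeas r⟩
    have hbind : κ ((t + s : ℝ≥0) : ℝ) x = (k s).comp (k t) x := by
      rw [NNReal.coe_add, hsemi t t.coe_nonneg s s.coe_nonneg]
      rfl
    have hcomp : ∫ y, e y ∂((k s).comp (k t) x) = ∫ y, ∫ z, e z ∂(k s y) ∂(k t x) :=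
      ProbabilityTheory.Kernel.integral_comp
        (hbind ▸ e.integrable_of_isFiniteMeasure (κ ((t + s : ℝ≥0) : ℝ) x))
    rw [hS, hS, hbind, hcomp]
    simp only [hS]
    rfl
  have hcont : ∀ e, Tendsto (fun t => S t e) (𝓝 0) (𝓝 e) := by
    intro e
    have hpos : Tendsto (fun t : ℝ => S t.toNNReal e) (𝓝[>] 0) (𝓝 e) := by
      refine tendsto_iff_norm_sub_tendsto_zero.2 ((hsc e).congr' ?_)
      filter_upwards [self_mem_nhdsWithin] with t ht
      simp only [ZeroAtInftyContinuousMap.norm_eq_iSup_abs, ZeroAtInftyContinuousMap.sub_apply,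
        hS' t ht]
    have hpos' : Tendsto (fun t : ℝ≥0 => S t e) (𝓝[>] 0) (𝓝 e) := by
      have hcoe : Tendsto ((↑) : ℝ≥0 → ℝ) (𝓝[>] 0) (𝓝[>] 0) :=
        tendsto_nhdsWithin_of_tendsto_nhds_of_eventually_within _
          ((NNReal.continuous_coe.tendsto 0).mono_left nhdsWithin_le_nhds)
          (eventually_mem_nhdsWithin.mono fun t ht => NNReal.coe_pos.2 ht)
      simpa [Function.comp_def] using hpos.comp hcoe
    have hcov : 𝓝 (0 : ℝ≥0) = pure 0 ⊔ 𝓝[>] 0 := by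
      have huniv : ({0} ∪ Set.Ioi 0 : Set ℝ≥0) = Set.univ :=
        Set.eq_univ_of_forall fun t => eq_zero_or_pos t
      rw [← nhdsWithin_singleton, ← nhdsWithin_union, huniv, nhdsWithin_univ]
    rw [hcov]
    refine Tendsto.sup ?_ hpos'
    rw [tendsto_pure_left]
    intro s hs
    simpa [hS0] using mem_of_mem_nhds hs
  let K := CompactExhaustion.choice X
  choose φ hφnorm hφ using fun n => f.exists_zeroAtInfty_eqOn (K.isCompact n)
  choose F G hFnorm hFφ hgen using fun n : ℕ =>
    exists_mem_generator_domain_near hS0 hadd hnorm (hcont (φ n))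
      (Nat.one_div_pos_of_nat (α := ℝ) (n := n))
  refine ⟨F, G, fun n => (hFnorm n).trans (hφnorm n), fun L hL => ?_, fun n => ?_⟩
  · obtain ⟨N, hN⟩ := K.exists_superset_of_isCompact hL
    refine Metric.tendstoUniformlyOn_iff.2 fun ε hε => ?_
    filter_upwards [eventually_ge_atTop N,
      tendsto_one_div_add_atTop_nhds_zero_nat.eventually_lt_const hε] with n hn hnε x hx
    rw [← hφ n (K.subset hn (hN hx)), dist_comm, Real.dist_eq]
    exact ((F n - φ n).abs_apply_le_norm x).trans_lt ((hFφ n).trans hnε)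
  · refine (tendsto_iff_norm_sub_tendsto_zero.1 (hgen n)).congr' ?_
    filter_upwards [self_mem_nhdsWithin] with t ht
    simp only [ZeroAtInftyContinuousMap.norm_eq_iSup_abs, ZeroAtInftyContinuousMap.sub_apply,
      ZeroAtInftyContinuousMap.smul_apply, smul_eq_mul, hS' t ht]
end
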